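/- Let g be a Lie algebra over a field K and let r ∈ g⊗g be skew-symmetric, τ(r) = −r (τ the flip of g⊗g), and satisfy the classical Yang–Baxter equation CYB(r) := [r₁₂, r₁₃] + [r₁₂, r₂₃] + [r₁₃, r₂₃] = 0 in g⊗g⊗g, where for r = Σᵢ xᵢ⊗yᵢ one sets [r₁₂, r₁₃] := Σ_{i,j} [xᵢ, xⱼ]⊗yᵢ⊗yⱼ, [r₁₂, r₂₃] := Σ_{i,j} xᵢ⊗[yᵢ, xⱼ]⊗yⱼ and [r₁₃, r₂₃] := Σ_{i,j} xᵢ⊗xⱼ⊗[yᵢ, yⱼ]. Then the subspace g_r := {(α⊗id)(r) : α ∈ g*} of g (the image of the linear map g* → g, α ↦ (α⊗id)(r)) is closed under the Lie bracket of g, i.e. g_r is a Lie subalgebra of g, and r lies in the image of g_r⊗g_r in g⊗g. -/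

import Mathlib

/-!
STATEMENT 13: For a skew-symmetric solution `r ∈ g⊗g` of the classical Yang–Baxter
equation over a field `K`, the subspace `g_r = {(α⊗id)(r) : α ∈ g*}` is a Lie
subalgebra of `g`, and `r` lies in the image of `g_r ⊗ g_r` in `g ⊗ g`.
-/

open TensorProduct

noncomputable section

namespace Stmt

/-- The subspace `g_r := {(α⊗id)(r) : α ∈ g*}` of `L` determined by `r ∈ L ⊗ L`. -/
def gr (K : Type*) [Field K] (L : Type*) [LieRing L] [LieAlgebra K L]
    (r : L ⊗[K] L) : Set L :=
  {z : L | ∃ α : Module.Dual K L,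
    z = TensorProduct.lid K L ((TensorProduct.map α LinearMap.id) r)}

theorem sep_left (K : Type*) [Field K] (L : Type*) [AddCommGroup L] [Module K L]
    (s t : L ⊗[K] L)
    (h : ∀ α : Module.Dual K L, TensorProduct.lid K L ((TensorProduct.map α LinearMap.id) s) =
      TensorProduct.lid K L ((TensorProduct.map α LinearMap.id) t)) : s = t := by
  classical
  let b := Module.Basis.ofVectorSpace K L
  apply (TensorProduct.equivFinsuppOfBasisLeft (N := L) b).injective
  ext k
  have := h (b.coord k)
  rw [TensorProduct.equivFinsuppOfBasisLeft_apply, TensorProduct.equivFinsuppOfBasisLeft_apply]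
  simpa [LinearMap.rTensor] using this

/-- **The symplectic leaf of a classical r-matrix.**  If `r ∈ g⊗g` is skew-symmetric
and satisfies the classical Yang–Baxter equation (written via a finite-sum
representation `r = Σᵢ xᵢ⊗yᵢ`), then `g_r` is closed under the Lie bracket (a Lie
subalgebra) and `r` lies in the image of `g_r ⊗ g_r` inside `g ⊗ g`. -/
theorem symplectic_leaf
    (K : Type*) [Field K] (L : Type*) [LieRing L] [LieAlgebra K L]
    (r : L ⊗[K] L)
    (hskew : TensorProduct.comm K L L r = -r)
    (n : ℕ) (x y : Fin n → L)
    (hr : r = ∑ i, x i ⊗ₜ[K] y i)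
    (hCYB : (∑ i, ∑ j, ⁅x i, x j⁆ ⊗ₜ[K] (y i ⊗ₜ[K] y j)) +
        (∑ i, ∑ j, x i ⊗ₜ[K] (⁅y i, x j⁆ ⊗ₜ[K] y j)) +
        (∑ i, ∑ j, x i ⊗ₜ[K] (x j ⊗ₜ[K] ⁅y i, y j⁆)) = (0 : L ⊗[K] (L ⊗[K] L))) :
    (∀ a b : L, a ∈ gr K L r → b ∈ gr K L r → ⁅a, b⁆ ∈ gr K L r) ∧
    r ∈ Submodule.span K
      {z : L ⊗[K] L | ∃ u ∈ gr K L r, ∃ v ∈ gr K L r, z = u ⊗ₜ[K] v} := by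
  let R : Module.Dual K L →ₗ[K] L :=
    { toFun := fun α => TensorProduct.lid K L ((TensorProduct.map α LinearMap.id) r)
      map_add' := fun α β => by simp [TensorProduct.map_add_left]
      map_smul' := fun c α => by simp [TensorProduct.map_smul_left] }
  have hRd : ∀ α, R α = TensorProduct.lid K L ((TensorProduct.map α LinearMap.id) r) :=
    fun _ => rfl
  have hR : ∀ α, R α = ∑ i, α (x i) • y i := by
    intro α
    rw [hRd, hr]
    simp [map_sum]
  constructor
  · rintro a b ⟨α, ha⟩ ⟨β, hb⟩
    rw [← hRd, hR] at ha hb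
    let γ : Module.Dual K L := α ∘ₗ (LieAlgebra.ad K L (∑ i, β (y i) • x i) : L →ₗ[K] L)
      + β ∘ₗ (LieAlgebra.ad K L a : L →ₗ[K] L)
    refine ⟨-γ, ?_⟩
    rw [← hRd, map_neg, hR, eq_neg_iff_add_eq_zero]
    have h := congrArg (fun t => TensorProduct.lid K L (TensorProduct.map α
      ((TensorProduct.lid K L).toLinearMap ∘ₗ TensorProduct.map β LinearMap.id) t)) hCYB
    simp only [map_add, map_sum, TensorProduct.map_tmul, LinearMap.comp_apply,
      LinearEquiv.coe_coe, TensorProduct.lid_tmul, LinearMap.id_apply, map_zero] at h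
    rw [← h, add_comm]
    congr 1
    · simp only [γ, LinearMap.add_apply, LinearMap.comp_apply, LieAlgebra.ad_apply, add_smul,
        Finset.sum_add_distrib, ha, sum_lie, smul_lie, map_sum, map_smul, Finset.sum_smul,
        LinearMap.sum_apply, LinearMap.smul_apply]
      congr 1
      · rw [Finset.sum_comm]
        simp only [smul_smul, smul_eq_mul, mul_comm]
      · rw [Finset.sum_comm]
        simp only [smul_smul, smul_eq_mul]
    · rw [ha, hb]
      simp only [sum_lie, lie_sum, smul_lie, lie_smul, Finset.smul_sum, smul_smul]
      rw [Finset.sum_comm]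
      simp only [mul_comm]
  · obtain ⟨p, hp⟩ : ∃ p : L →ₗ[K] L, (∀ z, p z ∈ LinearMap.range R) ∧
        ∀ z ∈ LinearMap.range R, p z = z := by
      obtain ⟨f, hf⟩ := (LinearMap.range R).subtype.exists_leftInverse_of_injective
        (by simp)
      refine ⟨(LinearMap.range R).subtype ∘ₗ f, fun z => (f z).2, fun z hz => ?_⟩
      have := LinearMap.congr_fun hf ⟨z, hz⟩
      simpa using congrArg Subtype.val this
    have h1 : TensorProduct.map LinearMap.id p r = r := by
      apply sep_left
      intro α
      have h := hp.2 (R α) ⟨α, rfl⟩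
      rw [← hRd α, ← h, hR, hr]
      simp [map_sum]
    have h2 : TensorProduct.map p LinearMap.id r = r := by
      have h := congrArg (TensorProduct.comm K L L) h1
      rw [← TensorProduct.map_comm, hskew, map_neg] at h
      exact neg_injective h
    have h3 : r = ∑ i, p (x i) ⊗ₜ[K] p (y i) := by
      conv_lhs => rw [← h1, ← h2, hr]
      simp [map_sum]
    have hg : ∀ z, p z ∈ gr K L r := by
      intro z
      obtain ⟨α, h⟩ := hp.1 z
      exact ⟨α, h.symm⟩
    have : ∑ i, p (x i) ⊗ₜ[K] p (y i) ∈ Submodule.span K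
        {z : L ⊗[K] L | ∃ u ∈ gr K L r, ∃ v ∈ gr K L r, z = u ⊗ₜ[K] v} :=
      Submodule.sum_mem _ fun i _ => Submodule.subset_span ⟨_, hg _, _, hg _, rfl⟩
    rwa [← h3] at this

end Stmt
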